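/- Fix t ≥ 1, B > 0, and δ ∈ [0, 1]. The map A ↦ q(δ; t, A, B) is non-decreasing on (0, ∞): if 0 < A_1 ≤ A_2 then q(δ; t, A_1, B) ≤ q(δ; t, A_2, B). -/

import Mathlib

open MeasureTheory ProbabilityTheory Real


/-- The law of the worst-case two-point random variable `G_i`:
`P(G = -a^2/b) = b^2/(a^2+b^2)`, `P(G = b) = a^2/(a^2+b^2)`. -/
noncomputable def twoPoint (a b : ℝ) : Measure ℝ :=
  (b ^ 2 / (a ^ 2 + b ^ 2)).toNNReal • Measure.dirac (-(a ^ 2) / b)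
    + (a ^ 2 / (a ^ 2 + b ^ 2)).toNNReal • Measure.dirac b

instance twoPoint_finite (a b : ℝ) : IsFiniteMeasure (twoPoint a b) := by
  unfold twoPoint; infer_instance

/-- Joint law of the independent two-point random variables `(G_1, ..., G_n)`. -/
noncomputable def gLaw (n : ℕ) (A : ℕ → ℝ) (b : ℝ) : Measure (Fin n → ℝ) :=
  Measure.pi fun i => twoPoint (A i) b

/-- `E[((G_1 + ... + G_n − x)_+)^2]`. -/
noncomputable def gMoment2 (n : ℕ) (A : ℕ → ℝ) (b x : ℝ) : ℝ :=
  ∫ g, (max ((∑ i, g i) - x) 0) ^ 2 ∂(gLaw n A b)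

/-- `P̃_{2,n}(u) = inf_{x ≤ u} E[((Σ G_i − x)_+)^2] / ((u − x)_+)^2`. -/
noncomputable def P2tilde (n : ℕ) (A : ℕ → ℝ) (b u : ℝ) : ℝ :=
  ⨅ x : {x : ℝ // x < u}, gMoment2 n A b (x : ℝ) / (u - (x : ℝ)) ^ 2

/-- `q(δ; n, 𝒜, B)`: generalized inverse of `P̃_{2,n}`. -/
noncomputable def bentkusQ (δ : ℝ) (n : ℕ) (A : ℕ → ℝ) (b : ℝ) : ℝ :=
  if δ < ((gLaw n A b) {g | (∑ i, g i) = (n : ℝ) * b}).toReal then (n : ℝ) * b + 1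
  else sInf {u : ℝ | P2tilde n A b u ≤ δ}

open Filter Topology

theorem isProbabilityMeasure_twoPoint (a : ℝ) {b : ℝ} (hb : 0 < b) :
    IsProbabilityMeasure (twoPoint a b) := by
  constructor
  have h : b ^ 2 / (a ^ 2 + b ^ 2) + a ^ 2 / (a ^ 2 + b ^ 2) = 1 := by
    have : a ^ 2 + b ^ 2 ≠ 0 := by positivity
    field_simp
    ring
  have h' : (b ^ 2 / (a ^ 2 + b ^ 2)).toNNReal + (a ^ 2 / (a ^ 2 + b ^ 2)).toNNReal = 1 := by
    rw [← Real.toNNReal_add (by positivity) (by positivity), h, Real.toNNReal_one]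
  simp only [twoPoint, Measure.coe_add, Measure.coe_nnreal_smul_apply, Pi.add_apply,
    measure_univ, mul_one]
  exact_mod_cast h'

theorem isProbabilityMeasure_gLaw (n : ℕ) (A : ℕ → ℝ) {b : ℝ} (hb : 0 < b) :
    IsProbabilityMeasure (gLaw n A b) := by
  have := fun i => isProbabilityMeasure_twoPoint (A i) hb
  unfold gLaw
  infer_instance

theorem gLaw_succ (n : ℕ) (a b : ℝ) :
    gLaw (n + 1) (fun _ => a) b =
      (b ^ 2 / (a ^ 2 + b ^ 2)).toNNReal •
          (gLaw n (fun _ => a) b).map (fun g => (Fin.cons (-(a ^ 2) / b) g : Fin (n + 1) → ℝ))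
        + (a ^ 2 / (a ^ 2 + b ^ 2)).toNNReal •
          (gLaw n (fun _ => a) b).map (fun g => (Fin.cons b g : Fin (n + 1) → ℝ)) := by
  have h := ((measurePreserving_piFinSuccAbove
    (fun _ : Fin (n + 1) => twoPoint a b) 0).symm).map_eq
  have hm := (MeasurableEquiv.piFinSuccAbove (fun _ : Fin (n + 1) => ℝ) 0).symm.measurable
  have hc (c : ℝ) : ((Measure.dirac c).prod (gLaw n (fun _ => a) b)).map
      (MeasurableEquiv.piFinSuccAbove (fun _ : Fin (n + 1) => ℝ) 0).symm
      = (gLaw n (fun _ => a) b).map (fun g => (Fin.cons c g : Fin (n + 1) → ℝ)) := by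
    rw [gLaw, Measure.dirac_prod, Measure.map_map hm (by fun_prop)]
    congr 1
    ext g i
    simp [MeasurableEquiv.piFinSuccAbove]
  change _ = gLaw (n + 1) (fun _ => a) b at h
  rw [← h, ← hc, ← hc, ← Measure.map_smul, ← Measure.map_smul, ← Measure.map_add _ _ hm]
  congr 1
  change (twoPoint a b).prod (gLaw n (fun _ => a) b) = _
  have : SFinite (gLaw n (fun _ => a) b) := by unfold gLaw; infer_instance
  conv_lhs => rw [twoPoint, Measure.add_prod]
  congr 1
  · exact Measure.prod_smul_left _
  · exact Measure.prod_smul_left _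

theorem continuous_fin_cons {n : ℕ} (c : ℝ) :
    Continuous fun g : Fin n → ℝ => (Fin.cons c g : Fin (n + 1) → ℝ) := by
  fun_prop

theorem integrable_gLaw (n : ℕ) (a b : ℝ) {f : (Fin n → ℝ) → ℝ} (hf : Continuous f) :
    Integrable f (gLaw n (fun _ => a) b) := by
  induction n with
  | zero =>
    have : IsFiniteMeasure (gLaw 0 (fun _ => a) b) := by unfold gLaw; infer_instance
    exact Integrable.of_finite
  | succ n ih =>
    rw [gLaw_succ, integrable_add_measure]
    have h (c : ℝ) : Integrable f
        ((gLaw n (fun _ => a) b).map (fun g => (Fin.cons c g : Fin (n + 1) → ℝ))) := by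
      rw [integrable_map_measure hf.aestronglyMeasurable
        (continuous_fin_cons c).measurable.aemeasurable]
      exact ih (hf.comp (continuous_fin_cons c))
    exact ⟨(h _).smul_measure_nnreal, (h _).smul_measure_nnreal⟩

theorem integral_gLaw_succ (n : ℕ) (a b : ℝ) {f : ℝ → ℝ} (hf : Continuous f) :
    ∫ g, f (∑ i, g i) ∂(gLaw (n + 1) (fun _ => a) b) =
      ∫ g, (b ^ 2 / (a ^ 2 + b ^ 2) * f (-(a ^ 2) / b + ∑ i, g i)
        + a ^ 2 / (a ^ 2 + b ^ 2) * f (b + ∑ i, g i)) ∂(gLaw n (fun _ => a) b) := by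
  have hF : Continuous fun g : Fin (n + 1) → ℝ => f (∑ i, g i) := by fun_prop
  have hint := integrable_gLaw (n + 1) a b hF
  have h (c : ℝ) : ∫ g, f (∑ i, g i)
      ∂((gLaw n (fun _ => a) b).map (fun g => (Fin.cons c g : Fin (n + 1) → ℝ)))
      = ∫ g, f (c + ∑ i, g i) ∂(gLaw n (fun _ => a) b) := by
    rw [integral_map (continuous_fin_cons c).measurable.aemeasurable hF.aestronglyMeasurable]
    simp [Fin.sum_univ_succ]
  have hi (c k : ℝ) : Integrable (fun g : Fin n → ℝ => k * f (c + ∑ i, g i))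
      (gLaw n (fun _ => a) b) := integrable_gLaw n a b (by fun_prop)
  rw [integral_add (hi _ _) (hi _ _), integral_const_mul, integral_const_mul, ← h, ← h]
  rw [gLaw_succ, integrable_add_measure] at hint
  rw [gLaw_succ, integral_add_measure hint.1 hint.2, integral_smul_nnreal_measure,
    integral_smul_nnreal_measure, NNReal.smul_def, NNReal.smul_def,
    Real.coe_toNNReal _ (by positivity), Real.coe_toNNReal _ (by positivity), smul_eq_mul,
    smul_eq_mul]

/-- The two-point laws increase with `a` in the convex order. -/
theorem twoPoint_average_mono {a₁ a₂ b : ℝ} (h₁ : 0 ≤ a₁) (hle : a₁ ≤ a₂) (hb : 0 < b)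
    {f : ℝ → ℝ} (hf : ConvexOn ℝ Set.univ f) (y : ℝ) :
    b ^ 2 / (a₁ ^ 2 + b ^ 2) * f (-(a₁ ^ 2) / b + y) + a₁ ^ 2 / (a₁ ^ 2 + b ^ 2) * f (b + y)
      ≤ b ^ 2 / (a₂ ^ 2 + b ^ 2) * f (-(a₂ ^ 2) / b + y)
        + a₂ ^ 2 / (a₂ ^ 2 + b ^ 2) * f (b + y) := by
  have hsq : a₁ ^ 2 ≤ a₂ ^ 2 := by gcongr
  have p₁ : 0 < a₁ ^ 2 + b ^ 2 := by positivity
  have p₂ : 0 < a₂ ^ 2 + b ^ 2 := by positivity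
  have key := hf.2 (Set.mem_univ (-(a₂ ^ 2) / b + y)) (Set.mem_univ (b + y))
    (show 0 ≤ (a₁ ^ 2 + b ^ 2) / (a₂ ^ 2 + b ^ 2) by positivity)
    (show 0 ≤ (a₂ ^ 2 - a₁ ^ 2) / (a₂ ^ 2 + b ^ 2) from div_nonneg (by linarith) p₂.le)
    (by field_simp; ring)
  have hpt : (a₁ ^ 2 + b ^ 2) / (a₂ ^ 2 + b ^ 2) * (-(a₂ ^ 2) / b + y)
      + (a₂ ^ 2 - a₁ ^ 2) / (a₂ ^ 2 + b ^ 2) * (b + y) = -(a₁ ^ 2) / b + y := by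
    field_simp
    ring
  simp only [smul_eq_mul, hpt] at key
  calc _ ≤ b ^ 2 / (a₁ ^ 2 + b ^ 2) * ((a₁ ^ 2 + b ^ 2) / (a₂ ^ 2 + b ^ 2) *
        f (-(a₂ ^ 2) / b + y) + (a₂ ^ 2 - a₁ ^ 2) / (a₂ ^ 2 + b ^ 2) * f (b + y))
        + a₁ ^ 2 / (a₁ ^ 2 + b ^ 2) * f (b + y) := by gcongr
    _ = _ := by field_simp; ring

theorem integral_gLaw_mono (n : ℕ) {a₁ a₂ b : ℝ} (h₁ : 0 ≤ a₁) (hle : a₁ ≤ a₂) (hb : 0 < b)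
    {f : ℝ → ℝ} (hf : ConvexOn ℝ Set.univ f) (hc : Continuous f) :
    ∫ g, f (∑ i, g i) ∂(gLaw n (fun _ => a₁) b) ≤ ∫ g, f (∑ i, g i) ∂(gLaw n (fun _ => a₂) b) := by
  induction n generalizing f with
  | zero =>
    have e : gLaw 0 (fun _ => a₁) b = gLaw 0 (fun _ => a₂) b := by
      unfold gLaw
      rw [Measure.pi_of_empty, Measure.pi_of_empty]
    rw [e]
  | succ n ih =>
    rw [integral_gLaw_succ n _ _ hc, integral_gLaw_succ n _ _ hc]
    let F (y : ℝ) : ℝ := b ^ 2 / (a₂ ^ 2 + b ^ 2) * f (-(a₂ ^ 2) / b + y)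
        + a₂ ^ 2 / (a₂ ^ 2 + b ^ 2) * f (b + y)
    have hshift (c : ℝ) : ConvexOn ℝ Set.univ fun y => f (c + y) := by
      simpa [Function.comp_def] using hf.translate_right c
    have hF : ConvexOn ℝ Set.univ F :=
      ((hshift _).smul (by positivity)).add ((hshift _).smul (by positivity))
    calc _ ≤ ∫ g, F (∑ i, g i) ∂(gLaw n (fun _ => a₁) b) :=
          integral_mono (integrable_gLaw n _ _ (by fun_prop)) (integrable_gLaw n _ _ (by fun_prop))
            fun g => twoPoint_average_mono h₁ hle hb hf _
      _ ≤ _ := ih hF (by fun_prop)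

theorem integral_gLaw_zero (n : ℕ) {b : ℝ} (hb : 0 < b) {f : ℝ → ℝ} (hc : Continuous f) :
    ∫ g, f (∑ i, g i) ∂(gLaw n (fun _ => 0) b) = f 0 := by
  induction n with
  | zero =>
    have := isProbabilityMeasure_gLaw 0 (fun _ => 0) hb
    simp
  | succ n ih =>
    rw [integral_gLaw_succ n _ _ hc]
    simp [hb.ne', ih]

theorem convexOn_max_sub_sq (x : ℝ) :
    ConvexOn ℝ Set.univ fun s : ℝ => (max (s - x) 0) ^ 2 := by
  have h : ConvexOn ℝ Set.univ fun s : ℝ => max (s - x) 0 :=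
    ((convexOn_id convex_univ).sub (concaveOn_const x convex_univ)).sup
      (convexOn_const 0 convex_univ)
  exact h.pow (fun s _ => le_max_right _ _) 2

theorem gMoment2_mono (n : ℕ) {a₁ a₂ b : ℝ} (h₁ : 0 ≤ a₁) (hle : a₁ ≤ a₂) (hb : 0 < b) (x : ℝ) :
    gMoment2 n (fun _ => a₁) b x ≤ gMoment2 n (fun _ => a₂) b x :=
  integral_gLaw_mono n h₁ hle hb (convexOn_max_sub_sq x) (by fun_prop)

theorem sq_max_neg_le_gMoment2 (n : ℕ) {a b : ℝ} (ha : 0 ≤ a) (hb : 0 < b) (x : ℝ) :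
    (max (-x) 0) ^ 2 ≤ gMoment2 n (fun _ => a) b x := by
  have h := gMoment2_mono n le_rfl ha hb x
  have h0 : gMoment2 n (fun _ => 0) b x = (max (0 - x) 0) ^ 2 :=
    integral_gLaw_zero n hb (f := fun s => (max (s - x) 0) ^ 2) (by fun_prop)
  rwa [h0, zero_sub] at h

theorem gMoment2_nonneg (n : ℕ) (A : ℕ → ℝ) (b x : ℝ) : 0 ≤ gMoment2 n A b x :=
  integral_nonneg fun _ => sq_nonneg _

theorem bddBelow_P2tilde_ratios (n : ℕ) (A : ℕ → ℝ) (b u : ℝ) :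
    BddBelow (Set.range fun x : {x : ℝ // x < u} =>
      gMoment2 n A b (x : ℝ) / (u - (x : ℝ)) ^ 2) := by
  refine ⟨0, ?_⟩
  rintro _ ⟨x, rfl⟩
  exact div_nonneg (gMoment2_nonneg _ _ _ _) (sq_nonneg _)

theorem P2tilde_le (n : ℕ) (A : ℕ → ℝ) (b : ℝ) {u x : ℝ} (hx : x < u) :
    P2tilde n A b u ≤ gMoment2 n A b x / (u - x) ^ 2 :=
  ciInf_le (bddBelow_P2tilde_ratios n A b u) ⟨x, hx⟩

theorem P2tilde_mono (n : ℕ) {a₁ a₂ b : ℝ} (h₁ : 0 ≤ a₁) (hle : a₁ ≤ a₂) (hb : 0 < b) (u : ℝ) :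
    P2tilde n (fun _ => a₁) b u ≤ P2tilde n (fun _ => a₂) b u :=
  ciInf_mono (bddBelow_P2tilde_ratios _ _ _ _) fun x => by
    have := gMoment2_mono n h₁ hle hb x
    gcongr

theorem one_le_P2tilde_of_neg (n : ℕ) {a b : ℝ} (ha : 0 ≤ a) (hb : 0 < b) {u : ℝ} (hu : u < 0) :
    1 ≤ P2tilde n (fun _ => a) b u := by
  have : Nonempty {x : ℝ // x < u} := ⟨⟨u - 1, by linarith⟩⟩
  refine le_ciInf fun ⟨x, hx⟩ => ?_
  rw [one_le_div (by have := sub_pos.2 hx; positivity)]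
  refine le_trans ?_ (sq_max_neg_le_gMoment2 n ha hb x)
  have : u - x ≤ max (-x) 0 := le_trans (by linarith) (le_max_left _ _)
  exact pow_le_pow_left₀ (sub_pos.2 hx).le this 2

theorem ae_gLaw_mem_atoms (n : ℕ) (a b : ℝ) :
    ∀ᵐ g ∂(gLaw n (fun _ => a) b), ∀ i, g i = -(a ^ 2) / b ∨ g i = b := by
  rw [ae_all_iff]
  intro i
  have h : ∀ᵐ s ∂(twoPoint a b), s = -(a ^ 2) / b ∨ s = b := by
    rw [twoPoint, ae_add_measure_iff]
    constructor <;> refine Measure.ae_smul_measure ?_ _ <;> simp [ae_dirac_eq]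
  exact (Measure.tendsto_eval_ae_ae (μ := fun _ : Fin n => twoPoint a b) (i := i)).eventually h

theorem ae_gLaw_sum_le (n : ℕ) (a : ℝ) {b : ℝ} (hb : 0 < b) :
    ∀ᵐ g ∂(gLaw n (fun _ => a) b),
      (∑ i, g i) = (n : ℝ) * b ∨ (∑ i, g i) ≤ (n : ℝ) * b - b := by
  filter_upwards [ae_gLaw_mem_atoms n a b] with g hg
  have hneg : -(a ^ 2) / b ≤ 0 := div_nonpos_of_nonpos_of_nonneg (by nlinarith) hb.le
  by_cases h : ∀ i, g i = b
  · left
    simp [h]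
  · right
    push Not at h
    obtain ⟨j, hj⟩ := h
    have hj' : g j ≤ 0 := by
      rw [(hg j).resolve_right hj]
      exact hneg
    have hs : ∑ i, g i ≤ ∑ i, (b - if i = j then b else 0) := by
      refine Finset.sum_le_sum fun i _ => ?_
      split_ifs with hij
      · subst hij
        linarith
      · rcases hg i with h | h <;> linarith
    simpa [Finset.sum_sub_distrib] using hs

theorem gMoment2_sub_self (n : ℕ) (a : ℝ) {b : ℝ} (hb : 0 < b) :
    gMoment2 n (fun _ => a) b (n * b - b) =
      ((gLaw n (fun _ => a) b) {g | (∑ i, g i) = (n : ℝ) * b}).toReal * b ^ 2 := by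
  have hm : MeasurableSet {g : Fin n → ℝ | (∑ i, g i) = (n : ℝ) * b} :=
    measurableSet_eq_fun (by fun_prop) (by fun_prop)
  have e : gMoment2 n (fun _ => a) b (n * b - b) =
      ∫ g, {g : Fin n → ℝ | (∑ i, g i) = (n : ℝ) * b}.indicator (fun _ => b ^ 2) g
        ∂(gLaw n (fun _ => a) b) := by
    refine integral_congr_ae ?_
    filter_upwards [ae_gLaw_sum_le n a hb] with g hg
    by_cases h : (∑ i, g i) = (n : ℝ) * b
    · rw [Set.indicator_of_mem (by exact h), h, sub_sub_cancel, max_eq_left hb.le]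
    · rw [Set.indicator_of_notMem (by exact h), max_eq_right (by linarith [hg.resolve_left h])]
      simp
  rw [e, integral_indicator_const _ hm, smul_eq_mul, measureReal_def]

theorem gMoment2_le (n : ℕ) (a : ℝ) {b x : ℝ} (hb : 0 < b) (hx : x ≤ n * b) :
    gMoment2 n (fun _ => a) b x ≤ (n * b - x) ^ 2 := by
  have := isProbabilityMeasure_gLaw n (fun _ => a) hb
  calc gMoment2 n (fun _ => a) b x ≤ ∫ _, (n * b - x) ^ 2 ∂(gLaw n (fun _ => a) b) := by
        refine integral_mono_ae (integrable_gLaw n _ _ (by fun_prop)) (integrable_const _) ?_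
        filter_upwards [ae_gLaw_sum_le n a hb] with g hg
        refine pow_le_pow_left₀ (le_max_right _ _) (max_le ?_ (by linarith)) 2
        rcases hg with h | h <;> linarith
    _ = (n * b - x) ^ 2 := by simp

theorem P2tilde_le_one (n : ℕ) (a : ℝ) {b : ℝ} (hb : 0 < b) (u : ℝ) :
    P2tilde n (fun _ => a) b u ≤ 1 := by
  have hlim : Tendsto (fun y : ℝ => (1 + (n * b - u) / y) ^ 2) atTop (𝓝 1) := by
    simpa using ((tendsto_const_nhds (x := (n * b - u))).div_atTop tendsto_id
      |>.const_add 1).pow 2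
  refine ge_of_tendsto hlim ?_
  filter_upwards [eventually_gt_atTop 0, eventually_ge_atTop (u - n * b)] with y hy hy'
  refine (P2tilde_le n _ b (x := u - y) (by linarith)).trans ?_
  have h := gMoment2_le n a hb (x := u - y) (by linarith)
  rw [sub_sub_cancel, div_le_iff₀ (by positivity)]
  refine h.trans_eq ?_
  field_simp
  ring

theorem P2tilde_top_le (n : ℕ) (a : ℝ) {b : ℝ} (hb : 0 < b) :
    P2tilde n (fun _ => a) b (n * b) ≤
      ((gLaw n (fun _ => a) b) {g | (∑ i, g i) = (n : ℝ) * b}).toReal := by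
  refine (P2tilde_le n _ b (x := n * b - b) (by linarith)).trans ?_
  rw [gMoment2_sub_self n a hb, sub_sub_cancel, mul_div_cancel_right₀ _ (by positivity)]

theorem gLaw_top_mono (n : ℕ) {a₁ a₂ b : ℝ} (h₁ : 0 ≤ a₁) (hle : a₁ ≤ a₂) (hb : 0 < b) :
    ((gLaw n (fun _ => a₁) b) {g | (∑ i, g i) = (n : ℝ) * b}).toReal ≤
      ((gLaw n (fun _ => a₂) b) {g | (∑ i, g i) = (n : ℝ) * b}).toReal := by
  have h := gMoment2_mono n h₁ hle hb (n * b - b)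
  rw [gMoment2_sub_self n _ hb, gMoment2_sub_self n _ hb] at h
  exact le_of_mul_le_mul_right h (by positivity)

theorem bddBelow_P2tilde_sublevel (n : ℕ) {a b δ : ℝ} (ha : 0 ≤ a) (hb : 0 < b) (hδ : δ < 1) :
    BddBelow {u : ℝ | P2tilde n (fun _ => a) b u ≤ δ} := by
  refine ⟨0, fun u hu => ?_⟩
  by_contra! h
  exact absurd (one_le_P2tilde_of_neg n ha hb h) (not_le.2 (lt_of_le_of_lt hu hδ))

/-- Lemma 4: the quantile `q(δ; t, A, B)` is non-decreasing in `A`. -/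
theorem bentkusQ_mono_in_A
    (t : ℕ) (ht : 1 ≤ t) (B : ℝ) (hB : 0 < B)
    (δ : ℝ) (hδ0 : 0 ≤ δ) (hδ1 : δ ≤ 1)
    (A1 A2 : ℝ) (hA1 : 0 < A1) (hle : A1 ≤ A2) :
    bentkusQ δ t (fun _ => A1) B ≤ bentkusQ δ t (fun _ => A2) B := by
  have hA2 : 0 < A2 := hA1.trans_le hle
  have hprob := gLaw_top_mono t hA1.le hle hB
  unfold bentkusQ
  rcases hδ1.eq_or_lt with rfl | hδ
  · have hp (a : ℝ) : ¬ 1 < ((gLaw t (fun _ => a) B) {g | (∑ i, g i) = (t : ℝ) * B}).toReal := by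
      have := isProbabilityMeasure_gLaw t (fun _ => a) hB
      exact not_lt.2 measureReal_le_one
    rw [if_neg (hp A1), if_neg (hp A2)]
    simp [P2tilde_le_one t _ hB]
  · split_ifs with h₁ h₂ h₂
    · exact le_rfl
    · exact absurd (h₁.trans_le hprob) h₂
    · have hmem : (t : ℝ) * B ∈ {u : ℝ | P2tilde t (fun _ => A1) B u ≤ δ} :=
        (P2tilde_top_le t A1 hB).trans (not_lt.1 h₁)
      have := csInf_le (bddBelow_P2tilde_sublevel t hA1.le hB hδ) hmem
      linarith
    · refine csInf_le_csInf (bddBelow_P2tilde_sublevel t hA1.le hB hδ) ?_ fun u hu => ?_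
      · exact ⟨t * B, (P2tilde_top_le t A2 hB).trans (not_lt.1 h₂)⟩
      · exact (P2tilde_mono t hA1.le hle hB u).trans hu
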